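/- arXiv:2502.07579 — 2 statements merged into one kernel-verified Lean document; each statement's English description precedes it below -/
import Mathlib

section
/- Fix N ≥ 1 and a time grid 0 = t_0 < t_1 < … < t_N = T with mesh Δt = max_{0 ≤ n < N} (t_{n+1} − t_n). Let V be a real normed vector space and suppose: (i) for each n, the learned consistency function f_θ(·, n) : V → V is L-Lipschitz; (ii) boundary conditions f_θ(y, N) = y and f(y, N) = y hold for all y ∈ V; (iii) the exact consistency function is constant along the true trajectory, i.e. f(x_{n+1}, n+1) = f(x_n, n) for all 0 ≤ n < N, where the true trajectory satisfies x_{n+1} = Φ_n(x_n) for flow maps Φ_n : V → V each of which is exp(L′(t_{n+1} − t_n))-Lipschitz; (iv) the solver trajectory satisfies x̂_0 = x_0 and has local error ‖x̂_{n+1} − Φ_n(x̂_n)‖ ≤ C (t_{n+1} − t_n)^{p+1} for all 0 ≤ n < N, with constants C ≥ 0, L′ ≥ 0, and an integer p ≥ 1; (v) the consistency distillation loss vanishes on the solver trajectory, i.e. f_θ(x̂_{n+1}, n+1) = f_θ(x̂_n, n) for all 0 ≤ n < N. Then for every 0 ≤ n ≤ N, ‖f_θ(x_n, n) − f(x_n,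 n)‖ ≤ 2 · L · C · exp(L′ · T) · T · (Δt)^p; in particular the uniform error of the learned consistency function over the grid is O((Δt)^p). -/
/-- Values on an initial segment of `ℕ` are ordered if consecutive ones are. -/
lemma le_of_forall_lt_le_succ {t : ℕ → ℝ} {N : ℕ} (ht : ∀ n < N, t n ≤ t (n + 1))
    {m n : ℕ} (hmn : m ≤ n) (hn : n ≤ N) : t m ≤ t n := by
  induction n, hmn using Nat.le_induction with
  | base => exact le_rfl
  | succ k _ ih => exact (ih (by omega)).trans (ht k (by omega))

/-- A quantity preserved by every step up to `N` equals its value at `N`. -/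
lemma eq_terminal_of_forall_lt {α : Type*} {u : ℕ → α} {N : ℕ}
    (hu : ∀ n < N, u (n + 1) = u n) {n : ℕ} (hn : n ≤ N) : u n = u N := by
  induction N, hn using Nat.le_induction with
  | base => rfl
  | succ k _ ih => exact (ih fun m hm => hu m (by omega)).trans (hu k (by omega)).symm

/-- Global error of a one-step method of order `p` in terms of its local error. -/
lemma one_step_global_error_le {V : Type*} [NormedAddCommGroup V]
    {N : ℕ} {t : ℕ → ℝ} (ht0 : t 0 = 0) (ht : ∀ n < N, t n ≤ t (n + 1))
    {Δt : ℝ} (hΔt : ∀ n < N, t (n + 1) - t n ≤ Δt)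
    {C L' : ℝ} (hC : 0 ≤ C) (hL' : 0 ≤ L') {p : ℕ} {Φ : ℕ → V → V}
    (hΦ : ∀ n < N, ∀ x y : V,
      ‖Φ n x - Φ n y‖ ≤ Real.exp (L' * (t (n + 1) - t n)) * ‖x - y‖)
    {x xh : ℕ → V} (hx : ∀ n < N, x (n + 1) = Φ n (x n)) (hx0 : xh 0 = x 0)
    (hloc : ∀ n < N, ‖xh (n + 1) - Φ n (xh n)‖ ≤ C * (t (n + 1) - t n) ^ (p + 1))
    {n : ℕ} (hn : n ≤ N) :
    ‖xh n - x n‖ ≤ C * Real.exp (L' * t n) * t n * Δt ^ p := by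
  induction n with
  | zero => simp [hx0, ht0]
  | succ k ih =>
    have hk : k < N := hn
    have hstep : 0 ≤ t (k + 1) - t k := sub_nonneg.mpr (ht k hk)
    have hnonneg : 0 ≤ t (k + 1) :=
      ht0.symm.le.trans (le_of_forall_lt_le_succ ht (Nat.zero_le _) hn)
    have hexp : 1 ≤ Real.exp (L' * t (k + 1)) := Real.one_le_exp (mul_nonneg hL' hnonneg)
    have hpow : (t (k + 1) - t k) ^ p ≤ Δt ^ p := pow_le_pow_left₀ hstep (hΔt k hk) p
    have hpow0 : 0 ≤ Δt ^ p := (pow_nonneg hstep p).trans hpow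
    have hlocal : C * (t (k + 1) - t k) ^ (p + 1) ≤
        C * Real.exp (L' * t (k + 1)) * (t (k + 1) - t k) * Δt ^ p := by
      calc C * (t (k + 1) - t k) ^ (p + 1)
          = C * 1 * (t (k + 1) - t k) * (t (k + 1) - t k) ^ p := by ring
        _ ≤ C * Real.exp (L' * t (k + 1)) * (t (k + 1) - t k) * Δt ^ p := by gcongr
    have hprop : Real.exp (L' * (t (k + 1) - t k)) * ‖xh k - x k‖ ≤
        C * Real.exp (L' * t (k + 1)) * t k * Δt ^ p := by
      calc Real.exp (L' * (t (k + 1) - t k)) * ‖xh k - x k‖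
          ≤ Real.exp (L' * (t (k + 1) - t k)) * (C * Real.exp (L' * t k) * t k * Δt ^ p) := by
            gcongr
            exact ih hk.le
        _ = C * (Real.exp (L' * (t (k + 1) - t k)) * Real.exp (L' * t k)) * t k * Δt ^ p := by
            ring
        _ = C * Real.exp (L' * t (k + 1)) * t k * Δt ^ p := by
            rw [← Real.exp_add]
            ring_nf
    calc ‖xh (k + 1) - x (k + 1)‖
        ≤ ‖xh (k + 1) - Φ k (xh k)‖ + ‖Φ k (xh k) - Φ k (x k)‖ := by
          rw [hx k hk]
          exact norm_sub_le_norm_sub_add_norm_sub _ _ _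
      _ ≤ C * Real.exp (L' * t (k + 1)) * (t (k + 1) - t k) * Δt ^ p +
            C * Real.exp (L' * t (k + 1)) * t k * Δt ^ p :=
          add_le_add ((hloc k hk).trans hlocal) ((hΦ k hk _ _).trans hprop)
      _ = C * Real.exp (L' * t (k + 1)) * t (k + 1) * Δt ^ p := by ring

/-- Discrete-time form of Theorem 4.1 (error bound for consistency distillation):
on a time grid `0 = t 0 < ⋯ < t N = T` with mesh `Δt`, if the learned consistency
function `fθ` is `L`-Lipschitz in space, both `fθ` and the exact consistency
function `f` equal the identity at the terminal index, `f` is constant along the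
exact trajectory generated by `exp (L' * (t (n+1) - t n))`-Lipschitz flow maps
`Φ n`, the solver trajectory starts at the exact initial point and has local
error at most `C * (t (n+1) - t n) ^ (p+1)`, and the consistency distillation
loss vanishes along the solver trajectory, then for every grid index `n`,
`‖fθ (x n) n - f (x n) n‖ ≤ 2 * L * C * exp (L' * T) * T * Δt ^ p`. -/
theorem consistency_distillation_error_bound
    {V : Type*} [NormedAddCommGroup V] [NormedSpace ℝ V]
    (N : ℕ) (hN : 1 ≤ N)
    (t : ℕ → ℝ) (T : ℝ)
    (ht0 : t 0 = 0) (htN : t N = T)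
    (htmono : ∀ n < N, t n < t (n + 1))
    (Δt : ℝ)
    (hΔt : Δt = (Finset.range N).sup' (Finset.nonempty_range_iff.mpr (by omega))
      (fun n => t (n + 1) - t n))
    (L C L' : ℝ) (hL : 0 ≤ L) (hC : 0 ≤ C) (hL' : 0 ≤ L')
    (p : ℕ) (hp : 1 ≤ p)
    (fθ f : V → ℕ → V)
    (hLip : ∀ n, ∀ x y : V, ‖fθ x n - fθ y n‖ ≤ L * ‖x - y‖)
    (hbθ : ∀ y : V, fθ y N = y)
    (hbf : ∀ y : V, f y N = y)
    (Φ : ℕ → V → V)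
    (hΦ : ∀ n < N, ∀ x y : V,
      ‖Φ n x - Φ n y‖ ≤ Real.exp (L' * (t (n + 1) - t n)) * ‖x - y‖)
    (x xh : ℕ → V)
    (hx : ∀ n < N, x (n + 1) = Φ n (x n))
    (hf : ∀ n < N, f (x (n + 1)) (n + 1) = f (x n) n)
    (hx0 : xh 0 = x 0)
    (hloc : ∀ n < N, ‖xh (n + 1) - Φ n (xh n)‖ ≤ C * (t (n + 1) - t n) ^ (p + 1))
    (hfθ : ∀ n < N, fθ (xh (n + 1)) (n + 1) = fθ (xh n) n) :
    ∀ n ≤ N,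
      ‖fθ (x n) n - f (x n) n‖ ≤ 2 * L * C * Real.exp (L' * T) * T * Δt ^ p := by
  intro n hn
  have ht : ∀ n < N, t n ≤ t (n + 1) := fun n hn => (htmono n hn).le
  have hmesh : ∀ n < N, t (n + 1) - t n ≤ Δt := fun n hn => by
    rw [hΔt]
    exact Finset.le_sup' (fun n => t (n + 1) - t n) (Finset.mem_range.mpr hn)
  have hΔt0 : 0 ≤ Δt := (sub_nonneg.mpr (ht 0 hN)).trans (hmesh 0 hN)
  have herr : ∀ n ≤ N, ‖xh n - x n‖ ≤ C * Real.exp (L' * T) * T * Δt ^ p := fun n hn => by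
    have htn : 0 ≤ t n := ht0.symm.le.trans (le_of_forall_lt_le_succ ht (Nat.zero_le n) hn)
    have htT : t n ≤ T := (le_of_forall_lt_le_succ ht hn le_rfl).trans htN.le
    refine (one_step_global_error_le ht0 ht hmesh hC hL' hΦ hx hx0 hloc hn).trans ?_
    gcongr
  have hexact : f (x n) n = x N :=
    (eq_terminal_of_forall_lt (u := fun n => f (x n) n) hf hn).trans (hbf _)
  have hlearned : fθ (xh n) n = fθ (xh N) N :=
    eq_terminal_of_forall_lt (u := fun n => fθ (xh n) n) hfθ hn
  calc ‖fθ (x n) n - f (x n) n‖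
      ≤ ‖fθ (x n) n - fθ (xh n) n‖ + ‖fθ (xh N) N - fθ (x N) N‖ := by
        rw [hexact, ← hlearned, hbθ (x N)]
        exact norm_sub_le_norm_sub_add_norm_sub _ _ _
    _ ≤ L * ‖xh n - x n‖ + L * ‖xh N - x N‖ := by
        rw [norm_sub_rev (xh n)]
        exact add_le_add (hLip _ _ _) (hLip _ _ _)
    _ ≤ L * (C * Real.exp (L' * T) * T * Δt ^ p) + L * (C * Real.exp (L' * T) * T * Δt ^ p) :=
        add_le_add (mul_le_mul_of_nonneg_left (herr n hn) hL)
          (mul_le_mul_of_nonneg_left (herr N le_rfl) hL)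
    _ = 2 * L * C * Real.exp (L' * T) * T * Δt ^ p := by ring
end

section
/- Let V be a real normed vector space, N ≥ 1, and let f_θ, f : V × {0, …, N} → V with f_θ(·, n) L-Lipschitz for every n. Let (x_n)_{n=0}^N and (x̂_n)_{n=0}^N be sequences in V such that f(x_{n+1}, n+1) = f(x_n, n) and f_θ(x̂_{n+1}, n+1) = f_θ(x̂_n, n) for all 0 ≤ n < N, and assume the terminal-time boundary conditions f_θ(y, N) = y and f(y, N) = y for all y ∈ V. Then for every 0 ≤ n ≤ N, ‖f_θ(x_n, n) − f(x_n, n)‖ ≤ L · ‖x_n − x̂_n‖ + L · ‖x_N − x̂_N‖. -/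
/-- A function that is constant along a trajectory and the identity at index `N` maps every point
of the trajectory up to `N` to its endpoint. -/
theorem eq_endpoint_of_constant_along {V : Type*} {N : ℕ} {g : V → ℕ → V} {x : ℕ → V}
    (hg : ∀ n < N, g (x (n + 1)) (n + 1) = g (x n) n) (hN : ∀ y, g y N = y)
    {n : ℕ} (hn : n ≤ N) : g (x n) n = x N := by
  induction hn using Nat.decreasingInduction with
  | self => exact hN _
  | of_succ k hk ih => rw [← hg k hk, ih]

/-- Lipschitz estimate concluding the proof of Theorem 4.1:
if `fθ (·, n)` is `L`-Lipschitz for each `n`, `f` is constant along the exact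
trajectory, `fθ` is constant along the solver trajectory, and both `fθ` and `f`
equal the identity at the terminal index `N`, then
`‖fθ (x n) n - f (x n) n‖ ≤ L * ‖x n - xh n‖ + L * ‖x N - xh N‖` for all `n ≤ N`. -/
theorem lipschitz_error_estimate
    {V : Type*} [NormedAddCommGroup V] [NormedSpace ℝ V]
    (N : ℕ) (hN : 1 ≤ N)
    (L : ℝ)
    (fθ f : V → ℕ → V)
    (hLip : ∀ n, ∀ x y : V, ‖fθ x n - fθ y n‖ ≤ L * ‖x - y‖)
    (x xh : ℕ → V)
    (hf : ∀ n < N, f (x (n + 1)) (n + 1) = f (x n) n)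
    (hfθ : ∀ n < N, fθ (xh (n + 1)) (n + 1) = fθ (xh n) n)
    (hbθ : ∀ y : V, fθ y N = y)
    (hbf : ∀ y : V, f y N = y) :
    ∀ n ≤ N,
      ‖fθ (x n) n - f (x n) n‖ ≤ L * ‖x n - xh n‖ + L * ‖x N - xh N‖ := by
  intro n hn
  have hend : ‖xh N - x N‖ ≤ L * ‖x N - xh N‖ := by
    simpa only [hbθ, norm_sub_rev (xh N)] using hLip N (x N) (xh N)
  calc ‖fθ (x n) n - f (x n) n‖
      = ‖(fθ (x n) n - fθ (xh n) n) + (xh N - x N)‖ := by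
        rw [eq_endpoint_of_constant_along hf hbf hn, eq_endpoint_of_constant_along hfθ hbθ hn,
          sub_add_sub_cancel]
    _ ≤ ‖fθ (x n) n - fθ (xh n) n‖ + ‖xh N - x N‖ := norm_add_le _ _
    _ ≤ L * ‖x n - xh n‖ + L * ‖x N - xh N‖ := add_le_add (hLip n _ _) hend
end
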